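/- Let $1\le d<n$ be integers. Let $\mathcal{A}:\Omega\to\mathbb{R}^{n\times n}$ be measurable and bounded with block decomposition $\mathcal{A}=\begin{pmatrix}\mathcal{A}_1&\mathcal{A}_2\\ 0&\mathcal{A}_4\end{pmatrix}$ (lower-left block identically zero), and assume $\mathcal{A}_4(x,t)^T\,\tfrac{t}{|t|}=\tfrac{t}{|t|}$ for all $(x,t)\in\Omega$. Fix $t_0\in\mathbb{R}^{n-d}$ with $|t_0|>0$ and define $u(x,t)=|t|/|t_0|$. Then $u$ is positive on $\Omega$, continuous on the closure of $\Omega$ with $u=0$ on $\{t=0\}$, equals $1$ at every point $(y,t)$ with $|t|=|t_0|$, and is a weak solution of $L^*u=-\mathop{\mathrm{div}}(|t|^{d+1-n}\mathcal{A}^T\nabla u)=0$ in $\Omega$, i.e. $\int_\Omega |t|^{d+1-n}\,\mathcal{A}(X)^T\nabla u(X)\cdot\nabla\varphi(X)\,dX=0$ for every Lipschitz $\varphi:\Omega\to\mathbb{R}$ with compact support in $\Omega$. -/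

import Mathlib

open MeasureTheory Metric Set
open scoped ENNReal NNReal

noncomputable section

/-- Points of the ambient space `ℝ^d × ℝ^m` (where `m = n - d`). -/
abbrev Pt (d m : ℕ) := EuclideanSpace ℝ (Fin d) × EuclideanSpace ℝ (Fin m)

/-- The vertical parameter set `T ⊆ ℝ^m`: it is `(0,∞)` when `m = 1`
(the codimension-one case `d = n-1`), and `ℝ^m \ {0}` otherwise. -/
def TSet (m : ℕ) : Set (EuclideanSpace ℝ (Fin m)) :=
  {t | t ≠ 0 ∧ (m = 1 → ∀ i, 0 < t i)}

/-- The domain `Ω`: `ℝ^{d+1}_+` when `m = 1`, and `ℝ^n \ ℝ^d` when `m ≥ 2`. -/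
def Omega (d m : ℕ) : Set (Pt d m) := {P | P.2 ∈ TSet m}

/-- Partial derivative of `u` in the `j`-th horizontal direction. -/
def pdx {d m : ℕ} (u : Pt d m → ℝ) (P : Pt d m) (j : Fin d) : ℝ :=
  fderiv ℝ u P ((EuclideanSpace.single j 1 : EuclideanSpace ℝ (Fin d)),
    (0 : EuclideanSpace ℝ (Fin m)))

/-- Partial derivative of `u` in the `i`-th vertical direction. -/
def pdt {d m : ℕ} (u : Pt d m → ℝ) (P : Pt d m) (i : Fin m) : ℝ :=
  fderiv ℝ u P ((0 : EuclideanSpace ℝ (Fin d)),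
    (EuclideanSpace.single i 1 : EuclideanSpace ℝ (Fin m)))

/-- The full gradient of `u`, indexed by `Fin d ⊕ Fin m`. -/
def grad {d m : ℕ} (u : Pt d m → ℝ) (P : Pt d m) : Fin d ⊕ Fin m → ℝ :=
  Sum.elim (pdx u P) (pdt u P)

/-- `|∇u|²`. -/
def gradSq {d m : ℕ} (u : Pt d m → ℝ) (P : Pt d m) : ℝ :=
  ∑ i : Fin d ⊕ Fin m, (grad u P i) ^ 2

/-- The Euclidean distance on `ℝ^d × ℝ^m = ℝ^n`. -/
def edist2 {d m : ℕ} (P Q : Pt d m) : ℝ :=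
  Real.sqrt (‖P.1 - Q.1‖ ^ 2 + ‖P.2 - Q.2‖ ^ 2)

/-- `u` is a weak solution of `- div (|t|^{d+1-n} M ∇u) = 0` in `U`, tested against
Lipschitz functions compactly supported in `U`.  (Note `d + 1 - n = 1 - m`.) -/
def IsWeakSolOn (d m : ℕ) (M : Pt d m → Matrix (Fin d ⊕ Fin m) (Fin d ⊕ Fin m) ℝ)
    (u : Pt d m → ℝ) (U : Set (Pt d m)) : Prop :=
  ∀ φ : Pt d m → ℝ, (∃ L : ℝ≥0, LipschitzWith L φ) → HasCompactSupport φ →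
    tsupport φ ⊆ U →
    ∫ P in U, ‖P.2‖ ^ ((1 : ℝ) - (m : ℝ)) *
      (∑ i, (∑ j, M P i j * grad u P j) * grad φ P i) = 0

/-- The ellipticity and boundedness conditions, with constant `CL`:
`M ξ · ξ ≥ CL⁻¹ |ξ|²` and `|M ξ · ζ| ≤ CL |ξ| |ζ|` on `Ω`. -/
def EllipticBounded (d m : ℕ) (M : Pt d m → Matrix (Fin d ⊕ Fin m) (Fin d ⊕ Fin m) ℝ)
    (CL : ℝ) : Prop :=
  ∀ P ∈ Omega d m, ∀ ξ ζ : Fin d ⊕ Fin m → ℝ,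
    CL⁻¹ * (∑ i, (ξ i) ^ 2) ≤ (∑ i, (∑ j, M P i j * ξ j) * ξ i) ∧
    |∑ i, (∑ j, M P i j * ξ j) * ζ i| ≤
      CL * Real.sqrt (∑ i, (ξ i) ^ 2) * Real.sqrt (∑ i, (ζ i) ^ 2)

/-- The nontangential maximal function `N(v)(x)`, valued in `ℝ≥0∞`. -/
def NtangE (d m : ℕ) (v : Pt d m → ℝ) (x : EuclideanSpace ℝ (Fin d)) : ℝ≥0∞ :=
  ⨆ P : {P : Pt d m // P ∈ Omega d m ∧ ‖P.1 - x‖ < ‖P.2‖}, ENNReal.ofReal |v P.val|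

/-- The wide-aperture nontangential maximal function `N₁₀(v)(x)`. -/
def N10E (d m : ℕ) (v : Pt d m → ℝ) (x : EuclideanSpace ℝ (Fin d)) : ℝ≥0∞ :=
  ⨆ P : {P : Pt d m // P ∈ Omega d m ∧ ‖P.1 - x‖ < 10 * ‖P.2‖}, ENNReal.ofReal |v P.val|

/-- Whitney ball `B((y,t), |t|/4)` (Euclidean ball of `ℝ^n`). -/
def whitneyBall {d m : ℕ} (P : Pt d m) : Set (Pt d m) := {Z | edist2 Z P < ‖P.2‖ / 4}

/-- The `L²` average `( ⨍_{B(P,|t|/4)} v² )^{1/2}`. -/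
def whitneyAvg (d m : ℕ) (v : Pt d m → ℝ) (P : Pt d m) : ℝ :=
  Real.sqrt ((∫ Z in whitneyBall P, (v Z) ^ 2) / (volume (whitneyBall P)).toReal)

/-- The averaged nontangential maximal function `Ñ(v)(x)`, real-valued. -/
def Ntilde (d m : ℕ) (v : Pt d m → ℝ) (x : EuclideanSpace ℝ (Fin d)) : ℝ :=
  ⨆ P : {P : Pt d m // P ∈ Omega d m ∧ ‖P.1 - x‖ < ‖P.2‖}, whitneyAvg d m v P.val

/-- The averaged nontangential maximal function `Ñ(v)(x)`, valued in `ℝ≥0∞`. -/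
def NtildeE (d m : ℕ) (v : Pt d m → ℝ) (x : EuclideanSpace ℝ (Fin d)) : ℝ≥0∞ :=
  ⨆ P : {P : Pt d m // P ∈ Omega d m ∧ ‖P.1 - x‖ < ‖P.2‖},
    ENNReal.ofReal (whitneyAvg d m v P.val)

/-- The Carleson box `B(x,r) × {0 < |t| < r}`. -/
def carlesonBox (d m : ℕ) (x : EuclideanSpace ℝ (Fin d)) (r : ℝ) : Set (Pt d m) :=
  (ball x r) ×ˢ {t : EuclideanSpace ℝ (Fin m) | 0 < ‖t‖ ∧ ‖t‖ < r}

/-- The Carleson measure condition `f ∈ CM₂(K)`. -/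
def CM2 (d m : ℕ) (f : Pt d m → ℝ) (K : ℝ) : Prop :=
  (∀ P ∈ Omega d m, |f P| ≤ K) ∧
  ∀ (x : EuclideanSpace ℝ (Fin d)) (r : ℝ), 0 < r →
    (∫⁻ P in carlesonBox d m x r,
      ENNReal.ofReal ((f P) ^ 2) / ENNReal.ofReal (‖P.2‖ ^ m))
      ≤ ENNReal.ofReal K * volume (ball x r)

/-- The Carleson measure condition `f ∈ C̃M₂(K)` with Whitney sup. -/
def CMtilde2 (d m : ℕ) (f : Pt d m → ℝ) (K : ℝ) : Prop :=
  ∀ (x : EuclideanSpace ℝ (Fin d)) (r : ℝ), 0 < r →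
    (∫⁻ P in carlesonBox d m x r,
      (⨆ Z : {Z : Pt d m // Z ∈ Omega d m ∧ edist2 Z P < ‖P.2‖ / 4},
        ENNReal.ofReal ((f Z.val) ^ 2)) / ENNReal.ofReal (‖P.2‖ ^ m))
      ≤ ENNReal.ofReal K * volume (ball x r)

/-- The fixed cut-off profile `φ`. -/
def cutoffProps (φ : ℝ → ℝ) : Prop :=
  ContDiff ℝ (⊤ : ℕ∞) φ ∧ (∀ s, 0 ≤ φ s ∧ φ s ≤ 1) ∧ (∀ s ∈ Ioo (-1 : ℝ) 1, φ s = 1) ∧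
    (∀ s, 2 ≤ s → φ s = 0) ∧ ∀ s, |deriv φ s| ≤ 2

/-- The cut-off `Ψ_B` adapted to the tent over the ball `B = B(xB, r) ⊆ ℝ^d`. -/
def PsiB (d m : ℕ) (φ : ℝ → ℝ) (xB : EuclideanSpace ℝ (Fin d)) (r : ℝ) (P : Pt d m) : ℝ :=
  φ (infDist P.1 (ball xB r) / ‖P.2‖) * φ (‖P.2‖ / r)

/-- The refined cut-off `Ψ_{B,ε}`. -/
def PsiBe (d m : ℕ) (φ : ℝ → ℝ) (xB : EuclideanSpace ℝ (Fin d)) (r ε : ℝ) (P : Pt d m) : ℝ :=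
  PsiB d m φ xB r P * φ (ε / ‖P.2‖)

/-- `div_x (Mᵀ) ∈ ℝ^{n-d}`: the `k`-th entry is `∑_j ∂_{x_j} M_{k j}`. -/
def divX {d m : ℕ} (B : Pt d m → Matrix (Fin m) (Fin d) ℝ) (P : Pt d m) (k : Fin m) : ℝ :=
  ∑ j, pdx (fun Q => B Q k j) P j

/-- `div_t M ∈ ℝ^d`: the `k`-th entry is `∑_i ∂_{t_i} M_{i k}`. -/
def divT {d m : ℕ} (B : Pt d m → Matrix (Fin m) (Fin d) ℝ) (P : Pt d m) (k : Fin d) : ℝ :=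
  ∑ i, pdt (fun Q => B Q i k) P i

/-- Frobenius norm of a matrix, used for `|C₃|`, `|C₄|`. -/
def frobNorm {a b : ℕ} (M : Matrix (Fin a) (Fin b) ℝ) : ℝ :=
  Real.sqrt (∑ i, ∑ j, (M i j) ^ 2)

/-- The radial derivative in the second variable of a compactly supported Lipschitz function
vanishing near `{t = 0}` integrates to zero against the scale-invariant weight `‖t‖⁻ᵐ`. -/
lemma integral_inv_norm_pow_mul_fderiv_radial_eq_zero {E V : Type*}
    [NormedAddCommGroup E] [NormedSpace ℝ E] [FiniteDimensional ℝ E]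
    [MeasurableSpace E] [BorelSpace E]
    [NormedAddCommGroup V] [NormedSpace ℝ V] [FiniteDimensional ℝ V]
    [MeasurableSpace V] [BorelSpace V]
    (μ : Measure E) [μ.IsAddHaarMeasure] (ν : Measure V) [ν.IsAddHaarMeasure]
    {φ : E × V → ℝ} {L : ℝ≥0} (hL : LipschitzWith L φ) (hc : HasCompactSupport φ)
    (h0 : ∀ P ∈ tsupport φ, P.2 ≠ 0) :
    ∫ P, (‖P.2‖ ^ Module.finrank ℝ V)⁻¹ * fderiv ℝ φ P (0, P.2) ∂(μ.prod ν) = 0 := by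
  have : ProperSpace E := FiniteDimensional.proper ℝ E
  have : ProperSpace V := FiniteDimensional.proper ℝ V
  set m := Module.finrank ℝ V with hm
  obtain ⟨δ, hδ, hδK⟩ := hc.isCompact.exists_forall_le'
    (f := fun P : E × V => ‖P.2‖) (a := 0) (by fun_prop)
    (fun P hP => norm_pos_iff.2 (h0 P hP))
  obtain ⟨R, hR, hRK⟩ := hc.isCompact.isBounded.exists_pos_norm_le
  let S : Set (E × V) := (closedBall 0 R ×ˢ closedBall 0 (2 * R)) ∩ {P | δ / 2 ≤ ‖P.2‖}
  have hSc : IsCompact S :=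
    ((isCompact_closedBall _ _).prod (isCompact_closedBall _ _)).inter_right
      (isClosed_le continuous_const (by fun_prop))
  have hSm : MeasurableSet S := hSc.measurableSet
  have hSfin : (μ.prod ν) S < ⊤ := hSc.measure_lt_top
  have hφS : ∀ s ∈ ball (1 : ℝ) (1 / 2), ∀ P ∉ S, φ (P.1, s • P.2) = 0 := by
    intro s hs P hP
    by_contra hne
    apply hP
    have hK : (P.1, s • P.2) ∈ tsupport φ := subset_tsupport φ hne
    have h1 := hδK _ hK
    have h2 := hRK _ hK
    rw [Real.ball_eq_Ioo] at hs
    have hs0 : 0 < s := by linarith [hs.1]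
    simp only [norm_smul, Real.norm_of_nonneg hs0.le] at h1
    have h3 := (norm_fst_le _).trans h2
    have h4 := (norm_snd_le _).trans h2
    simp only [norm_smul, Real.norm_of_nonneg hs0.le] at h3 h4
    have hn := norm_nonneg P.2
    refine ⟨⟨by simpa using h3, ?_⟩, ?_⟩
    · simp only [mem_closedBall, dist_zero_right]
      nlinarith [hs.1]
    · simp only [mem_ofPred_eq]
      nlinarith [hs.2]
  have hw : ∀ P ∈ S, (‖P.2‖ ^ m)⁻¹ ≤ ((δ / 2) ^ m)⁻¹ := by
    intro P hP
    have : δ / 2 ≤ ‖P.2‖ := hP.2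
    gcongr
  have hwmeas : Measurable fun P : E × V => (‖P.2‖ ^ m)⁻¹ := by fun_prop
  have hφs : ∀ s : ℝ, Continuous fun P : E × V => φ (P.1, s • P.2) := by
    intro s
    have := hL.continuous
    fun_prop
  have hFmeas : ∀ s : ℝ, AEStronglyMeasurable
      (fun P : E × V => (‖P.2‖ ^ m)⁻¹ * φ (P.1, s • P.2)) (μ.prod ν) := fun s =>
    (hwmeas.mul (hφs s).measurable).aestronglyMeasurable
  obtain ⟨C, hC⟩ := hc.exists_bound_of_continuous hL.continuous
  have hFint : ∀ s ∈ ball (1 : ℝ) (1 / 2), Integrable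
      (fun P : E × V => (‖P.2‖ ^ m)⁻¹ * φ (P.1, s • P.2)) (μ.prod ν) := by
    intro s hs
    refine Integrable.mono' (g := S.indicator fun _ => ((δ / 2) ^ m)⁻¹ * C)
      ((integrable_indicator_iff hSm).2 (integrableOn_const hSfin.ne)) (hFmeas s)
      (Filter.Eventually.of_forall fun P => ?_)
    by_cases hP : P ∈ S
    · rw [indicator_of_mem hP, norm_mul, Real.norm_of_nonneg (by positivity)]
      exact mul_le_mul (hw P hP) (hC _) (norm_nonneg _) (by positivity)
    · simp [hφS s hs P hP, indicator_of_notMem hP]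
  have hconst : ∀ s ∈ ball (1 : ℝ) (1 / 2),
      ∫ P, (‖P.2‖ ^ m)⁻¹ * φ (P.1, s • P.2) ∂(μ.prod ν) =
        ∫ P, (‖P.2‖ ^ m)⁻¹ * φ (P.1, (1 : ℝ) • P.2) ∂(μ.prod ν) := by
    intro s hs
    rw [integral_prod _ (hFint s hs), integral_prod _ (hFint 1 (by simp))]
    congr 1 with x
    have hs0 : 0 < s := by
      rw [Real.ball_eq_Ioo] at hs
      linarith [hs.1]
    have key := Measure.integral_comp_smul ν (fun t : V => (‖t‖ ^ m)⁻¹ * φ (x, t)) s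
    rw [← hm, abs_of_pos (by positivity), smul_eq_mul] at key
    simp only [norm_smul, Real.norm_of_nonneg hs0.le, mul_pow, mul_inv, mul_assoc] at key
    rw [integral_const_mul] at key
    simpa using mul_left_cancel₀ (by positivity) key
  have hdiff : ∀ᵐ P ∂(μ.prod ν), HasDerivAt
      (fun s : ℝ => (‖P.2‖ ^ m)⁻¹ * φ (P.1, s • P.2))
      ((‖P.2‖ ^ m)⁻¹ * fderiv ℝ φ P (0, P.2)) 1 := by
    filter_upwards [hL.ae_differentiableAt (μ := μ.prod ν)] with P hP
    refine HasDerivAt.const_mul _ ?_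
    have h1 : HasDerivAt (fun s : ℝ => (P.1, s • P.2)) (0, P.2) 1 := by
      simpa using (hasDerivAt_const (1 : ℝ) P.1).prodMk ((hasDerivAt_id (1 : ℝ)).smul_const P.2)
    have h2 : HasFDerivAt φ (fderiv ℝ φ P) (P.1, (1 : ℝ) • P.2) := by
      simpa using hP.hasFDerivAt
    exact h2.comp_hasDerivAt (1 : ℝ) h1
  have hlip : ∀ᵐ P ∂(μ.prod ν), LipschitzOnWith
      (Real.nnabs (S.indicator (fun _ => ((δ / 2) ^ m)⁻¹ * (L * (2 * R))) P))
      (fun s : ℝ => (‖P.2‖ ^ m)⁻¹ * φ (P.1, s • P.2)) (ball 1 (1 / 2)) := by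
    refine Filter.Eventually.of_forall fun P => LipschitzOnWith.of_dist_le_mul fun s hs r hr => ?_
    by_cases hP : P ∈ S
    · have hP2 : ‖P.2‖ ≤ 2 * R := by simpa using hP.1.2
      have h1 : dist (φ (P.1, s • P.2)) (φ (P.1, r • P.2)) ≤ L * (2 * R) * dist s r := by
        refine (hL.dist_le_mul _ _).trans ?_
        have : dist (P.1, s • P.2) (P.1, r • P.2) = dist s r * ‖P.2‖ := by
          rw [Prod.dist_eq, dist_self, max_eq_right dist_nonneg, dist_eq_norm, ← sub_smul,
            norm_smul, ← dist_eq_norm]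
        rw [this, mul_assoc, mul_comm (dist s r)]
        gcongr
      rw [indicator_of_mem hP, Real.coe_nnabs, abs_of_nonneg (by positivity), Real.dist_eq,
        ← mul_sub, abs_mul, abs_of_nonneg (by positivity), ← Real.dist_eq, mul_assoc]
      exact mul_le_mul (hw P hP) h1 dist_nonneg (by positivity)
    · rw [hφS s hs P hP, hφS r hr P hP, dist_self]
      positivity
  have hradial : Measurable fun P : E × V => fderiv ℝ φ P (0, P.2) :=
    isBoundedBilinearMap_apply.continuous.measurable.comp
      ((measurable_fderiv ℝ φ).prodMk (by fun_prop : Measurable fun P : E × V => ((0 : E), P.2)))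
  have hderiv := (hasDerivAt_integral_of_dominated_loc_of_lip
    (bound := S.indicator fun _ => ((δ / 2) ^ m)⁻¹ * (L * (2 * R)))
    (F := fun (s : ℝ) (P : E × V) => (‖P.2‖ ^ m)⁻¹ * φ (P.1, s • P.2))
    (ball_mem_nhds (1 : ℝ) (by norm_num : (0 : ℝ) < 1 / 2)) (Filter.Eventually.of_forall hFmeas)
    (hFint 1 (by simp)) (hwmeas.mul hradial).aestronglyMeasurable hlip
    ((integrable_indicator_iff hSm).2 (integrableOn_const hSfin.ne)) hdiff).2
  refine hderiv.unique ((hasDerivAt_const (1 : ℝ)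
    (∫ P, (‖P.2‖ ^ m)⁻¹ * φ (P.1, (1 : ℝ) • P.2) ∂(μ.prod ν))).congr_of_eventuallyEq ?_)
  filter_upwards [ball_mem_nhds (1 : ℝ) (by norm_num : (0 : ℝ) < 1 / 2)] with s hs
  exact hconst s hs

lemma measurableSet_Omega (d m : ℕ) : MeasurableSet (Omega d m) := by
  have h : Omega d m = {P : Pt d m | P.2 ≠ 0} ∩ {P : Pt d m | m = 1 → ∀ i, 0 < P.2 i} := rfl
  rw [h]
  refine MeasurableSet.inter ?_ ?_
  · exact (isOpen_ne_fun continuous_snd continuous_const).measurableSet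
  · by_cases hm : m = 1
    · simp only [hm, forall_const, ofPred_forall]
      exact MeasurableSet.iInter fun i => (isOpen_lt continuous_const (by fun_prop)).measurableSet
    · simp [hm]

lemma fderiv_norm_snd_div {d m : ℕ} {u : Pt d m → ℝ} {c : ℝ} (hu : ∀ P, u P = ‖P.2‖ / c)
    {P : Pt d m} (hP : P.2 ≠ 0) (v : Pt d m) :
    fderiv ℝ u P v = inner ℝ P.2 v.2 / ‖P.2‖ / c := by
  have hpos : 0 < ‖P.2‖ := norm_pos_iff.2 hP
  have h1 : HasFDerivAt (fun Q : Pt d m => ‖Q.2‖ ^ 2) _ P := hasFDerivAt_snd.norm_sq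
  have h2 := (h1.sqrt (by positivity)).mul_const c⁻¹
  have h3 : u = fun Q => √(‖Q.2‖ ^ 2) * c⁻¹ := by
    ext Q
    rw [hu, Real.sqrt_sq (norm_nonneg _), div_eq_mul_inv]
  rw [h3, h2.fderiv]
  simp [Real.sqrt_sq (norm_nonneg _)]
  field_simp

lemma sum_mul_pdt {d m : ℕ} (φ : Pt d m → ℝ) (P : Pt d m) (t : EuclideanSpace ℝ (Fin m)) :
    ∑ i, t i * pdt φ P i = fderiv ℝ φ P (0, t) := by
  have h : ((0, t) : Pt d m) = ∑ i, t i • ((0, EuclideanSpace.single i 1) : Pt d m) := by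
    refine Prod.ext (by simp [Prod.fst_sum]) ?_
    ext j
    simp [Prod.snd_sum, Pi.single_apply]
  rw [h, map_sum]
  simp only [pdt, map_smul, smul_eq_mul]

/-- When the lower-left block of `B` vanishes and `t / ‖t‖` is fixed by the transpose of the
lower-right block, the flux of `‖t‖ / ‖t₀‖` is a radial field. -/
lemma weight_mul_flux_eq {d m : ℕ} (P : Pt d m) (B : Matrix (Fin d ⊕ Fin m) (Fin d ⊕ Fin m) ℝ)
    (hP : P.2 ≠ 0) (hB3 : ∀ (i : Fin m) (j : Fin d), B (Sum.inr i) (Sum.inl j) = 0)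
    (hB4 : ∀ i : Fin m, (∑ k, B (Sum.inr k) (Sum.inr i) * (P.2 k / ‖P.2‖)) = P.2 i / ‖P.2‖)
    (t0 : EuclideanSpace ℝ (Fin m)) {u : Pt d m → ℝ} (hu : ∀ P : Pt d m, u P = ‖P.2‖ / ‖t0‖)
    (φ : Pt d m → ℝ) :
    ‖P.2‖ ^ ((1 : ℝ) - (m : ℝ)) * (∑ i, (∑ j, B.transpose i j * grad u P j) * grad φ P i) =
      ‖t0‖⁻¹ * ((‖P.2‖ ^ m)⁻¹ * fderiv ℝ φ P (0, P.2)) := by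
  have hpos : 0 < ‖P.2‖ := norm_pos_iff.2 hP
  have hx : ∀ j, pdx u P j = 0 := fun j => by simp [pdx, fderiv_norm_snd_div hu hP]
  have ht : ∀ k, pdt u P k = P.2 k / ‖P.2‖ * ‖t0‖⁻¹ := fun k => by
    simp [pdt, fderiv_norm_snd_div hu hP, EuclideanSpace.inner_single_right, div_eq_mul_inv]
  simp only [Fintype.sum_sum_type, grad, Sum.elim_inl, Sum.elim_inr, Matrix.transpose_apply, hx,
    ht, hB3, mul_zero, zero_mul, Finset.sum_const_zero, zero_add, ← mul_assoc, ← Finset.sum_mul]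
  rw [← sum_mul_pdt, Real.rpow_sub hpos, Real.rpow_one, Real.rpow_natCast]
  simp only [hB4, Finset.mul_sum]
  refine Finset.sum_congr rfl fun i _ => ?_
  field_simp

/-- Corollary 3.2 of the paper, in verifiable form.
If the lower-left block of `𝒜` vanishes and `𝒜₄ᵀ (t/|t|) = t/|t|`, then
`u(x,t) = |t|/|t₀|` is positive on `Ω`, continuous up to the boundary, vanishes on
`{t = 0}`, is normalized at `|t| = |t₀|`, and solves `L* u = 0` weakly in `Ω`. -/
theorem statement1 (d n : ℕ) (hd : 1 ≤ d) (hdn : d < n)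
    (A : Pt d (n - d) → Matrix (Fin d ⊕ Fin (n - d)) (Fin d ⊕ Fin (n - d)) ℝ)
    (hAmeas : ∀ i j, Measurable fun P => A P i j)
    (hAbdd : ∃ M : ℝ, ∀ P ∈ Omega d (n - d), ∀ i j, |A P i j| ≤ M)
    -- lower-left block identically zero
    (hA3 : ∀ P ∈ Omega d (n - d), ∀ (i : Fin (n - d)) (j : Fin d),
      A P (Sum.inr i) (Sum.inl j) = 0)
    -- `𝒜₄(x,t)ᵀ (t/|t|) = t/|t|`
    (hA4 : ∀ P ∈ Omega d (n - d), ∀ i : Fin (n - d),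
      (∑ k, A P (Sum.inr k) (Sum.inr i) * (P.2 k / ‖P.2‖)) = P.2 i / ‖P.2‖)
    (t0 : EuclideanSpace ℝ (Fin (n - d))) (ht0 : 0 < ‖t0‖)
    (u : Pt d (n - d) → ℝ) (hu : ∀ P : Pt d (n - d), u P = ‖P.2‖ / ‖t0‖) :
    (∀ P ∈ Omega d (n - d), 0 < u P) ∧
    ContinuousOn u (closure (Omega d (n - d))) ∧
    (∀ x : EuclideanSpace ℝ (Fin d), u (x, 0) = 0) ∧
    (∀ P : Pt d (n - d), ‖P.2‖ = ‖t0‖ → u P = 1) ∧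
    IsWeakSolOn d (n - d) (fun P => (A P).transpose) u (Omega d (n - d)) := by
  refine ⟨?_, ?_, ?_, ?_, ?_⟩
  · intro P hP
    rw [hu]
    exact div_pos (norm_pos_iff.2 hP.1) ht0
  · rw [funext hu]
    fun_prop
  · simp [hu]
  · intro P hP
    rw [hu, hP, div_self ht0.ne']
  · rintro φ ⟨L, hL⟩ hc hsupp
    rw [setIntegral_congr_fun (measurableSet_Omega d (n - d)) fun P hP =>
      weight_mul_flux_eq P (A P) hP.1 (hA3 P hP) (hA4 P hP) t0 hu φ,
      setIntegral_eq_integral_of_forall_compl_eq_zero]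
    · rw [integral_const_mul]
      have key := integral_inv_norm_pow_mul_fderiv_radial_eq_zero
        (volume : Measure (EuclideanSpace ℝ (Fin d)))
        (volume : Measure (EuclideanSpace ℝ (Fin (n - d)))) hL hc fun P hP => (hsupp hP).1
      rw [finrank_euclideanSpace_fin] at key
      rw [Measure.volume_eq_prod, key, mul_zero]
    · intro P hP
      have hf : fderiv ℝ φ P = 0 := by
        by_contra hne
        exact hP (hsupp (support_fderiv_subset ℝ hne))
      simp [hf]
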